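/- Let A be an abelian category and let (T, F) be a torsion theory on A: a pair of full additive subcategories such that Hom(T₀, F₀) = 0 for every T₀ ∈ T and F₀ ∈ F, and every object A₀ of A fits in a short exact sequence 0 → t → A₀ → f → 0 with t ∈ T and f ∈ F. Define full subcategories of the derived category D(A): 𝔻^{≤0} = { X : H^i(X) = 0 for all i > 0 and H^0(X) ∈ T } and 𝔻^{≥0} = { X : H^i(X) = 0 for all i < −1 and H^{−1}(X) ∈ F }. Then (𝔻^{≤0}, 𝔻^{≥0}) is a t-structure on D(A). -/

import Mathlib

open CategoryTheory Limits Pretriangulated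

universe w v u

variable {A : Type u} [Category.{v} A] [Abelian A] [HasDerivedCategory.{w} A]

/-- `𝔻^{≤0}`, the aisle of the t-structure associated to a torsion class `T`:
complexes `X` with `Hⁱ(X) = 0` for `i > 0` and `H⁰(X) ∈ T`. -/
def TorsionDLE (T : Set A) : Set (DerivedCategory A) :=
  {X | (∀ i : ℤ, 0 < i → IsZero ((DerivedCategory.homologyFunctor A i).obj X)) ∧
    (DerivedCategory.homologyFunctor A 0).obj X ∈ T}

/-- `𝔻^{≥0}`, the coaisle of the t-structure associated to a torsion-free class `F`:
complexes `X` with `Hⁱ(X) = 0` for `i < −1` and `H⁻¹(X) ∈ F`. -/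
def TorsionDGE (F : Set A) : Set (DerivedCategory A) :=
  {X | (∀ i : ℤ, i < -1 → IsZero ((DerivedCategory.homologyFunctor A i).obj X)) ∧
    (DerivedCategory.homologyFunctor A (-1)).obj X ∈ F}

open Triangulated

namespace DerivedCategory

open TStructure

lemma isLE_obj₃_of_distTriang {X Y Z : DerivedCategory A} {f : X ⟶ Y} {g : Y ⟶ Z}
    {h : Z ⟶ X⟦(1 : ℤ)⟧} (hT : Triangle.mk f g h ∈ distTriang _) (n : ℤ)
    [X.IsLE (n + 1)] [Y.IsLE n] : Z.IsLE n :=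
  t.isLE₂ _ (rot_of_distTriang _ hT) n ‹_› (t.isLE_shift X (n + 1) 1 n)

lemma isGE_obj₁_of_distTriang {X Y Z : DerivedCategory A} {f : X ⟶ Y} {g : Y ⟶ Z}
    {h : Z ⟶ X⟦(1 : ℤ)⟧} (hT : Triangle.mk f g h ∈ distTriang _) (n : ℤ)
    [Y.IsGE n] [Z.IsGE (n - 1)] : X.IsGE n :=
  t.isGE₂ _ (inv_rot_of_distTriang _ hT) n (t.isGE_shift Z (n - 1) (-1) n) ‹_›

/-- A distinguished triangle whose third object is `≥ n + 1` induces an isomorphism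
between the cohomologies in degree `n` of its first two objects. -/
lemma nonempty_homology_iso₁₂ {X Y Z : DerivedCategory A} {f : X ⟶ Y} {g : Y ⟶ Z}
    {h : Z ⟶ X⟦(1 : ℤ)⟧} (hT : Triangle.mk f g h ∈ distTriang _) (n : ℤ)
    [Z.IsGE (n + 1)] :
    Nonempty ((homologyFunctor A n).obj X ≅ (homologyFunctor A n).obj Y) := by
  have : Mono ((homologyFunctor A n).map f) :=
    (HomologySequence.mono_homologyMap_mor₁_iff _ hT (n - 1) n).2
      ((Z.isZero_of_isGE (n + 1) (n - 1) (by lia)).eq_of_src _ _)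
  have : Epi ((homologyFunctor A n).map f) :=
    (HomologySequence.epi_homologyMap_mor₁_iff _ hT n).2
      ((Z.isZero_of_isGE (n + 1) n (by lia)).eq_of_tgt _ _)
  have := isIso_of_mono_of_epi ((homologyFunctor A n).map f)
  exact ⟨asIso ((homologyFunctor A n).map f)⟩

/-- A distinguished triangle whose first object is `≤ n - 1` induces an isomorphism
between the cohomologies in degree `n` of its last two objects. -/
lemma nonempty_homology_iso₂₃ {X Y Z : DerivedCategory A} {f : X ⟶ Y} {g : Y ⟶ Z}
    {h : Z ⟶ X⟦(1 : ℤ)⟧} (hT : Triangle.mk f g h ∈ distTriang _) (n : ℤ)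
    [X.IsLE (n - 1)] :
    Nonempty ((homologyFunctor A n).obj Y ≅ (homologyFunctor A n).obj Z) := by
  have : Mono ((homologyFunctor A n).map g) :=
    (HomologySequence.mono_homologyMap_mor₂_iff _ hT n).2
      ((X.isZero_of_isLE (n - 1) n (by lia)).eq_of_src _ _)
  have : Epi ((homologyFunctor A n).map g) :=
    (HomologySequence.epi_homologyMap_mor₂_iff _ hT n (n + 1)).2
      ((X.isZero_of_isLE (n - 1) (n + 1) (by lia)).eq_of_tgt _ _)
  have := isIso_of_mono_of_epi ((homologyFunctor A n).map g)
  exact ⟨asIso ((homologyFunctor A n).map g)⟩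

lemma nonempty_homology_shift_iso (X : DerivedCategory A) (n a m : ℤ) (h : n + a = m) :
    Nonempty ((homologyFunctor A a).obj (X⟦n⟧) ≅ (homologyFunctor A m).obj X) :=
  ⟨((homologyFunctor A 0).shiftIso n a m h).app X⟩

lemma nonempty_iso_singleFunctor_obj_homology (X : DerivedCategory A) (n : ℤ)
    [X.IsGE n] [X.IsLE n] :
    Nonempty (X ≅ (singleFunctor A n).obj ((homologyFunctor A n).obj X)) := by
  obtain ⟨M, ⟨e⟩⟩ := exists_iso_singleFunctor_obj_of_isGE_of_isLE X n
  exact ⟨e ≪≫ (singleFunctor A n).mapIso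
    ((singleFunctorCompHomologyFunctorIso A n).symm.app M ≪≫
      (homologyFunctor A n).mapIso e.symm)⟩

/-- An object `X ≤ n` is an extension of `Hⁿ(X)`, placed in degree `n`, by
an object `≤ n - 1`. -/
lemma exists_triangle_singleFunctor_of_isLE (X : DerivedCategory A) (n : ℤ) [X.IsLE n] :
    ∃ (W : DerivedCategory A) (_ : W.IsLE (n - 1)) (f : W ⟶ X)
      (g : X ⟶ (singleFunctor A n).obj ((homologyFunctor A n).obj X))
      (h : (singleFunctor A n).obj ((homologyFunctor A n).obj X) ⟶ W⟦(1 : ℤ)⟧),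
      Triangle.mk f g h ∈ distTriang _ := by
  obtain ⟨W, Z, hW, hZ, f, g, h, hT⟩ := t.exists_triangle X (n - 1) n (by lia)
  have : W.IsLE (n - 1) := ⟨hW⟩
  have : Z.IsGE n := ⟨hZ⟩
  have : W.IsLE (n + 1) := t.isLE_of_le W (n - 1) (n + 1)
  have : Z.IsLE n := isLE_obj₃_of_distTriang hT n
  obtain ⟨e⟩ := nonempty_homology_iso₂₃ hT n
  obtain ⟨e'⟩ := nonempty_iso_singleFunctor_obj_homology Z n
  let i := e' ≪≫ (singleFunctor A n).mapIso e.symm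
  exact ⟨W, inferInstance, f, g ≫ i.hom, i.inv ≫ h, isomorphic_distinguished _ hT _
    (Triangle.isoMk _ _ (Iso.refl _) (Iso.refl _) i.symm
      (by change f ≫ 𝟙 X = 𝟙 W ≫ f; simp) (by change (g ≫ i.hom) ≫ i.inv = 𝟙 X ≫ g; simp)
      (by change (i.inv ≫ h) ≫ (𝟙 W)⟦(1 : ℤ)⟧' = i.inv ≫ h; simp))⟩

/-- An object `X ≥ n` is an extension of an object `≥ n + 1` by `Hⁿ(X)`, placed
in degree `n`. -/
lemma exists_triangle_singleFunctor_of_isGE (X : DerivedCategory A) (n : ℤ) [X.IsGE n] :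
    ∃ (Z : DerivedCategory A) (_ : Z.IsGE (n + 1))
      (f : (singleFunctor A n).obj ((homologyFunctor A n).obj X) ⟶ X) (g : X ⟶ Z)
      (h : Z ⟶ ((singleFunctor A n).obj ((homologyFunctor A n).obj X))⟦(1 : ℤ)⟧),
      Triangle.mk f g h ∈ distTriang _ := by
  obtain ⟨W, Z, hW, hZ, f, g, h, hT⟩ := t.exists_triangle X n (n + 1) rfl
  have : W.IsLE n := ⟨hW⟩
  have : Z.IsGE (n + 1) := ⟨hZ⟩
  have : Z.IsGE (n - 1) := t.isGE_of_ge Z (n - 1) (n + 1)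
  have : W.IsGE n := isGE_obj₁_of_distTriang hT n
  obtain ⟨e⟩ := nonempty_homology_iso₁₂ hT n
  obtain ⟨e'⟩ := nonempty_iso_singleFunctor_obj_homology W n
  let i := e' ≪≫ (singleFunctor A n).mapIso e
  exact ⟨Z, inferInstance, i.inv ≫ f, g, h ≫ i.hom⟦(1 : ℤ)⟧', isomorphic_distinguished _ hT _
    (Triangle.isoMk _ _ i.symm (Iso.refl _) (Iso.refl _)
      (by change (i.inv ≫ f) ≫ 𝟙 X = i.inv ≫ f; simp) (by change g ≫ 𝟙 Z = 𝟙 X ≫ g; simp)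
      (by change (h ≫ i.hom⟦(1 : ℤ)⟧') ≫ i.inv⟦(1 : ℤ)⟧' = 𝟙 Z ≫ h; simp [← Functor.map_comp]))⟩

/-- A morphism from `X ≤ n` to `Y ≥ n` vanishes as soon as there is no nonzero morphism
from `Hⁿ(X)` to `Hⁿ(Y)`. -/
lemma eq_zero_of_homology_hom_eq_zero {X Y : DerivedCategory A} (n : ℤ) [X.IsLE n] [Y.IsGE n]
    (hXY : ∀ φ : (homologyFunctor A n).obj X ⟶ (homologyFunctor A n).obj Y, φ = 0)
    (f : X ⟶ Y) : f = 0 := by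
  obtain ⟨W, _, a, b, c, hT⟩ := exists_triangle_singleFunctor_of_isLE X n
  obtain ⟨Z, _, a', b', c', hT'⟩ := exists_triangle_singleFunctor_of_isGE Y n
  obtain ⟨g, hg⟩ : ∃ g, f = b ≫ g :=
    Triangle.yoneda_exact₂ _ hT f (t.zero (X := W) (Y := Y) _ (n - 1) n)
  obtain ⟨k, hk⟩ : ∃ k, g = k ≫ a' :=
    Triangle.coyoneda_exact₂ _ hT' g (t.zero (Y := Z) _ n (n + 1))
  obtain ⟨φ, rfl⟩ := (singleFunctor A n).map_surjective k
  rw [hg, hk, hXY φ, Functor.map_zero, zero_comp, comp_zero]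

/-- A short exact sequence `0 ⟶ M ⟶ H⁰(X) ⟶ N ⟶ 0` yields a distinguished triangle
`P ⟶ X ⟶ R ⟶ P⟦1⟧` with `P ≤ 0`, `R ≥ 0`, `H⁰(P) ≅ M` and `H⁰(R) ≅ N`. -/
lemma exists_triangle_of_shortExact_homology (X : DerivedCategory A) {M N : A}
    {i : M ⟶ (homologyFunctor A 0).obj X} {p : (homologyFunctor A 0).obj X ⟶ N} {w : i ≫ p = 0}
    (hS : (ShortComplex.mk i p w).ShortExact) :
    ∃ (P R : DerivedCategory A) (f : P ⟶ X) (g : X ⟶ R) (h : R ⟶ P⟦(1 : ℤ)⟧),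
      P.IsLE 0 ∧ R.IsGE 0 ∧ Nonempty (M ≅ (homologyFunctor A 0).obj P) ∧
        Nonempty (N ≅ (homologyFunctor A 0).obj R) ∧
          Triangle.mk f g h ∈ distTriang (DerivedCategory A) := by
  obtain ⟨W, V, hW, hV, a, b, c, hT⟩ := t.exists_triangle X (-1) 0 rfl
  have : W.IsLE (-1) := ⟨hW⟩
  have : W.IsLE (0 - 1) := this
  have : V.IsGE 0 := ⟨hV⟩
  obtain ⟨eV⟩ := nonempty_homology_iso₂₃ hT 0
  obtain ⟨Z, _, a', b', c', hT'⟩ := exists_triangle_singleFunctor_of_isGE V 0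
  let u := (singleFunctor A 0).map (i ≫ eV.hom) ≫ a'
  have hS' : (ShortComplex.mk (i ≫ eV.hom) (eV.inv ≫ p) (by simpa)).ShortExact :=
    ShortComplex.shortExact_of_iso (S₁ := ShortComplex.mk i p w)
      (ShortComplex.isoMk (S₁ := ShortComplex.mk i p w) (Iso.refl _) eV (Iso.refl _) (by simp) (by simp)) hS
  obtain ⟨R, v, x, hR⟩ := distinguished_cocone_triangle u
  -- `N ⟶ R ⟶ Z`
  have hNRZ := (someOctahedron rfl hS'.singleTriangle_distinguished hT' hR).mem
  obtain ⟨P, f, h, hP⟩ := distinguished_cocone_triangle₁ (b ≫ v)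
  -- `W⟦1⟧ ⟶ P⟦1⟧ ⟶ M⟦1⟧`
  have hWPM := (someOctahedron rfl (rot_of_distTriang _ hT) (rot_of_distTriang _ hR)
    (rot_of_distTriang _ hP)).mem
  have : R.IsGE 0 := t.isGE₂ _ hNRZ 0 (inferInstanceAs (((singleFunctor A 0).obj N).IsGE 0))
    (t.isGE_of_ge Z 0 (0 + 1))
  have : (W⟦(1 : ℤ)⟧).IsLE (-1 - 1) := t.isLE_shift W (-1) 1 (-1 - 1)
  have : (P⟦(1 : ℤ)⟧).IsLE (-1) := t.isLE₂ _ hWPM (-1)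
    (t.isLE_of_le (W⟦(1 : ℤ)⟧) (-1 - 1) (-1))
    (t.isLE_shift ((singleFunctor A 0).obj M) 0 1 (-1))
  obtain ⟨e₁⟩ := nonempty_homology_iso₁₂ hNRZ 0
  obtain ⟨e₂⟩ := nonempty_homology_iso₂₃ (X := W⟦(1 : ℤ)⟧) (Y := P⟦(1 : ℤ)⟧)
    (Z := ((singleFunctor A 0).obj M)⟦(1 : ℤ)⟧) hWPM (-1)
  obtain ⟨e₃⟩ := nonempty_homology_shift_iso P 1 (-1) 0 rfl
  obtain ⟨e₄⟩ := nonempty_homology_shift_iso ((singleFunctor A 0).obj M) 1 (-1) 0 rfl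
  exact ⟨P, R, f, b ≫ v, h, t.isLE_of_shift P 0 1 (-1), inferInstance,
    ⟨(singleFunctorCompHomologyFunctorIso A 0).symm.app M ≪≫ e₄.symm ≪≫ e₂.symm ≪≫ e₃⟩,
    ⟨(singleFunctorCompHomologyFunctorIso A 0).symm.app N ≪≫ e₁⟩, hP⟩

end DerivedCategory

open DerivedCategory DerivedCategory.TStructure

lemma mem_torsionDLE_iff (T : Set A) (X : DerivedCategory A) :
    X ∈ TorsionDLE T ↔ X.IsLE 0 ∧ (homologyFunctor A 0).obj X ∈ T := by
  rw [isLE_iff]; rfl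

lemma mem_torsionDGE_iff (F : Set A) (X : DerivedCategory A) :
    X ∈ TorsionDGE F ↔ X.IsGE (-1) ∧ (homologyFunctor A (-1)).obj X ∈ F := by
  rw [isGE_iff]; rfl

lemma shift_mem_torsionDGE_iff (F : Set A) (hF : ∀ {X Y : A}, (X ≅ Y) → X ∈ F → Y ∈ F)
    (X : DerivedCategory A) :
    X⟦(1 : ℤ)⟧ ∈ TorsionDGE F ↔ X.IsGE 0 ∧ (homologyFunctor A 0).obj X ∈ F := by
  obtain ⟨e⟩ := nonempty_homology_shift_iso X 1 (-1) 0 (by lia)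
  rw [mem_torsionDGE_iff]
  exact and_congr (t.isGE_shift_iff X 0 1 (-1)) ⟨hF e, hF e.symm⟩

/-- A torsion theory `(T, F)` on an abelian category `A` (a pair of strictly full additive
subcategories with no nonzero morphisms from `T` to `F`, such that every object is an
extension of an object of `F` by an object of `T`) gives rise to a t-structure
`(𝔻^{≤0}, 𝔻^{≥0})` on the derived category `D(A)`. -/
theorem torsion_theory_tStructure
    (T F : Set A)
    -- `T` and `F` are strictly full additive subcategories:
    (hT_iso : ∀ {X Y : A}, (X ≅ Y) → X ∈ T → Y ∈ T)
    (hF_iso : ∀ {X Y : A}, (X ≅ Y) → X ∈ F → Y ∈ F)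
    (hT_zero : ∀ X : A, IsZero X → X ∈ T)
    (hF_zero : ∀ X : A, IsZero X → X ∈ F)
    (hT_add : ∀ X Y : A, X ∈ T → Y ∈ T → (X ⊞ Y) ∈ T)
    (hF_add : ∀ X Y : A, X ∈ F → Y ∈ F → (X ⊞ Y) ∈ F)
    -- no nonzero morphisms from `T` to `F`:
    (hHom : ∀ (X Y : A), X ∈ T → Y ∈ F → ∀ f : X ⟶ Y, f = 0)
    -- every object fits in a short exact sequence `0 → t → A₀ → f → 0`, `t ∈ T`, `f ∈ F`:
    (hSES : ∀ A₀ : A, ∃ (t f : A) (i : t ⟶ A₀) (p : A₀ ⟶ f) (w : i ≫ p = 0),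
      t ∈ T ∧ f ∈ F ∧ (ShortComplex.mk i p w).ShortExact) :
    -- `(𝔻^{≤0}, 𝔻^{≥0})` is a t-structure on `D(A)`:
    (∀ (X Y : DerivedCategory A), X ∈ TorsionDLE T → Y⟦(1 : ℤ)⟧ ∈ TorsionDGE F →
      ∀ f : X ⟶ Y, f = 0) ∧
    ((∀ X : DerivedCategory A, X ∈ TorsionDLE T → X⟦(1 : ℤ)⟧ ∈ TorsionDLE T) ∧
     (∀ Y : DerivedCategory A, Y⟦(1 : ℤ)⟧ ∈ TorsionDGE F → Y ∈ TorsionDGE F)) ∧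
    (∀ X : DerivedCategory A, ∃ (A₀ B₀ : DerivedCategory A) (f : A₀ ⟶ X) (g : X ⟶ B₀)
      (h : B₀ ⟶ A₀⟦(1 : ℤ)⟧), A₀ ∈ TorsionDLE T ∧ B₀⟦(1 : ℤ)⟧ ∈ TorsionDGE F ∧
        Triangle.mk f g h ∈ distTriang (DerivedCategory A)) := by
  refine ⟨fun X Y hX hY f ↦ ?_, ⟨fun X hX ↦ ?_, fun Y hY ↦ ?_⟩, fun X ↦ ?_⟩
  · rw [mem_torsionDLE_iff] at hX
    rw [shift_mem_torsionDGE_iff F hF_iso] at hY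
    have := hX.1
    have := hY.1
    exact eq_zero_of_homology_hom_eq_zero 0 (hHom _ _ hX.2 hY.2) f
  · rw [mem_torsionDLE_iff] at hX ⊢
    have := hX.1
    have : (X⟦(1 : ℤ)⟧).IsLE (-1) := t.isLE_shift X 0 1 (-1)
    exact ⟨t.isLE_of_le _ (-1) 0, hT_zero _ (isZero_of_isLE _ (-1) 0 (by lia))⟩
  · rw [shift_mem_torsionDGE_iff F hF_iso] at hY
    rw [mem_torsionDGE_iff]
    have := hY.1
    exact ⟨t.isGE_of_ge _ (-1) 0, hF_zero _ (isZero_of_isGE _ 0 (-1) (by lia))⟩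
  · obtain ⟨M, N, i, p, w, hM, hN, hS⟩ := hSES ((homologyFunctor A 0).obj X)
    obtain ⟨P, R, f, g, h, hP, hR, ⟨e⟩, ⟨e'⟩, hT⟩ := exists_triangle_of_shortExact_homology X hS
    exact ⟨P, R, f, g, h, (mem_torsionDLE_iff T P).2 ⟨hP, hT_iso e hM⟩,
      (shift_mem_torsionDGE_iff F hF_iso R).2 ⟨hR, hF_iso e' hN⟩, hT⟩
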